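/- The logics ITL⁰, ITL^FS, ITL^CD and ITL¹ are pairwise distinct as sets of formulas. Specifically: ITL⁰ ⊊ ITL^FS, ITL⁰ ⊊ ITL^CD, ITL^FS and ITL^CD are incomparable (CD(p,q) ∈ ITL^CD ∖ ITL^FS and FS◦(p,q) ∈ ITL^FS ∖ ITL^CD), and both are strictly contained in ITL¹. -/

import Mathlib

/-- Formulas of the language `L` of intuitionistic linear temporal logic. -/
inductive Formula : Type
  | bot : Formula
  | var : ℕ → Formula
  | and : Formula → Formula → Formula
  | or : Formula → Formula → Formula
  | impl : Formula → Formula → Formula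
  | next : Formula → Formula
  | diam : Formula → Formula
  | box : Formula → Formula
deriving DecidableEq

namespace Formula

/-- `¬φ` abbreviates `φ → ⊥`. -/
def neg (φ : Formula) : Formula := impl φ bot

/-- `φ ↔ ψ` abbreviates `(φ → ψ) ∧ (ψ → φ)`. -/
def iff (φ ψ : Formula) : Formula := and (impl φ ψ) (impl ψ φ)

end Formula

/-- Derivability in `ITL⁰` extended with an additional set of axioms `Ax`.
The intuitionistic propositional tautologies are generated by a standard
complete Hilbert-style axiomatization of intuitionistic propositional logic
(closed under modus ponens). -/
inductive ITL (Ax : Formula → Prop) : Formula → Prop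
  | extra {φ} : Ax φ → ITL Ax φ
  -- (i) intuitionistic propositional axioms
  | then1 (φ ψ : Formula) : ITL Ax (.impl φ (.impl ψ φ))
  | then2 (φ ψ χ : Formula) :
      ITL Ax (.impl (.impl φ (.impl ψ χ)) (.impl (.impl φ ψ) (.impl φ χ)))
  | andE1 (φ ψ : Formula) : ITL Ax (.impl (.and φ ψ) φ)
  | andE2 (φ ψ : Formula) : ITL Ax (.impl (.and φ ψ) ψ)
  | andI (φ ψ : Formula) : ITL Ax (.impl φ (.impl ψ (.and φ ψ)))
  | orI1 (φ ψ : Formula) : ITL Ax (.impl φ (.or φ ψ))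
  | orI2 (φ ψ : Formula) : ITL Ax (.impl ψ (.or φ ψ))
  | orE (φ ψ χ : Formula) :
      ITL Ax (.impl (.impl φ χ) (.impl (.impl ψ χ) (.impl (.or φ ψ) χ)))
  | botE (φ : Formula) : ITL Ax (.impl .bot φ)
  -- (ii)–(x) temporal axioms
  | nextBot : ITL Ax (.neg (.next .bot))
  | nextAnd (φ ψ : Formula) :
      ITL Ax (.iff (.next (.and φ ψ)) (.and (.next φ) (.next ψ)))
  | nextOr (φ ψ : Formula) :
      ITL Ax (.iff (.next (.or φ ψ)) (.or (.next φ) (.next ψ)))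
  | nextK (φ ψ : Formula) :
      ITL Ax (.impl (.next (.impl φ ψ)) (.impl (.next φ) (.next ψ)))
  | boxK (φ ψ : Formula) :
      ITL Ax (.impl (.box (.impl φ ψ)) (.impl (.box φ) (.box ψ)))
  | diamK (φ ψ : Formula) :
      ITL Ax (.impl (.box (.impl φ ψ)) (.impl (.diam φ) (.diam ψ)))
  | diamOr (φ ψ : Formula) :
      ITL Ax (.impl (.diam (.or φ ψ)) (.or (.diam φ) (.diam ψ)))
  | boxFix (φ : Formula) : ITL Ax (.impl (.box φ) (.and φ (.next (.box φ))))
  | diamFix (φ : Formula) : ITL Ax (.impl (.or φ (.next (.diam φ))) (.diam φ))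
  -- rules (xi)–(xiv)
  | ind1 {φ : Formula} : ITL Ax (.impl φ (.next φ)) → ITL Ax (.impl φ (.box φ))
  | ind2 {φ : Formula} : ITL Ax (.impl (.next φ) φ) → ITL Ax (.impl (.diam φ) φ)
  | mp {φ ψ : Formula} : ITL Ax (.impl φ ψ) → ITL Ax φ → ITL Ax ψ
  | nec {φ : Formula} : ITL Ax φ → ITL Ax (.next φ)

/-- The Fischer Servi axiom schemes FS◦ and FS◇. -/
def FSAx : Formula → Prop := fun χ => ∃ φ ψ : Formula,
  χ = .impl (.impl (.next φ) (.next ψ)) (.next (.impl φ ψ)) ∨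
  χ = .impl (.impl (.diam φ) (.box ψ)) (.box (.impl φ ψ))

/-- The constant domain axiom scheme CD. -/
def CDAx : Formula → Prop := fun χ => ∃ φ ψ : Formula,
  χ = .impl (.box (.or φ ψ)) (.or (.box φ) (.diam ψ))

/-- The logic ITL⁰. -/
def ITL0 : Formula → Prop := ITL (fun _ => False)

/-- The logic ITL^FS = ITL⁰ + FS◦ + FS◇. -/
def ITLFS : Formula → Prop := ITL FSAx

/-- The logic ITL^CD = ITL⁰ + CD. -/
def ITLCD : Formula → Prop := ITL CDAx

/-- The logic ITL¹ = ITL^FS + ITL^CD. -/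
def ITL1 : Formula → Prop := ITL (fun χ => FSAx χ ∨ CDAx χ)

/-- A valuation on a dynamical topological system `(X, T, S)`: a map from
formulas to open sets satisfying the semantic clauses. -/
structure DTValuation (X : Type) (T : TopologicalSpace X) (S : X → X) where
  val : Formula → Set X
  isOpen_val : ∀ φ, @IsOpen X T (val φ)
  val_bot : val .bot = ∅
  val_and : ∀ φ ψ, val (.and φ ψ) = val φ ∩ val ψ
  val_or : ∀ φ ψ, val (.or φ ψ) = val φ ∪ val ψ
  val_impl : ∀ φ ψ, val (.impl φ ψ) = @interior X T ((val φ)ᶜ ∪ val ψ)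
  val_next : ∀ φ, val (.next φ) = S ⁻¹' val φ
  val_diam : ∀ φ, val (.diam φ) = ⋃ n : ℕ, (S^[n]) ⁻¹' val φ
  val_box : ∀ φ, val (.box φ) =
    ⋃₀ {U : Set X | @IsOpen X T U ∧ S '' U ⊆ U ∧ U ⊆ val φ}

/-- The up-set topology of a preorder: the open sets are the upward closed sets. -/
def upsetTopology (X : Type) [Preorder X] : TopologicalSpace X where
  IsOpen U := IsUpperSet U
  isOpen_univ := isUpperSet_univ
  isOpen_inter := fun _ _ hU hV => hU.inter hV
  isOpen_sUnion := fun _ hs => isUpperSet_sUnion hs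

/-- The propositional variables `p` and `q`. -/
def pVar : Formula := .var 0
def qVar : Formula := .var 1

open TopologicalSpace

section Algebraic

variable {H : Type*} [Order.Frame H] (f : FrameHom H H)

/-- The greatest `b ≤ a` with `b ≤ f b`. -/
def frameBox (a : H) : H := sSup {b | b ≤ f b ∧ b ≤ a}

/-- The least `b ≥ a` with `f b ≤ b`. -/
def frameDiam (a : H) : H := sInf {b | f b ≤ b ∧ a ≤ b}

variable {f}

theorem frameBox_le (a : H) : frameBox f a ≤ a := sSup_le fun _ h => h.2

theorem le_frameBox {a b : H} (hb : b ≤ f b) (hba : b ≤ a) : b ≤ frameBox f a :=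
  le_sSup ⟨hb, hba⟩

theorem frameBox_le_map (a : H) : frameBox f a ≤ f (frameBox f a) :=
  sSup_le fun _ h => h.1.trans (OrderHomClass.mono f (le_frameBox h.1 h.2))

theorem le_frameDiam (a : H) : a ≤ frameDiam f a := le_sInf fun _ h => h.2

theorem frameDiam_le {a b : H} (hb : f b ≤ b) (hab : a ≤ b) : frameDiam f a ≤ b :=
  sInf_le ⟨hb, hab⟩

theorem map_frameDiam_le (a : H) : f (frameDiam f a) ≤ frameDiam f a :=
  le_sInf fun _ h => (OrderHomClass.mono f (frameDiam_le h.1 h.2)).trans h.1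

theorem map_himp_le_himp_map (a b : H) : f (a ⇨ b) ≤ f a ⇨ f b := by
  rw [le_himp_iff, ← map_inf]
  exact OrderHomClass.mono f himp_inf_le

theorem frameBox_himp_le (a b : H) : frameBox f (a ⇨ b) ≤ frameBox f a ⇨ frameBox f b := by
  rw [le_himp_iff]
  apply le_frameBox
  · rw [map_inf]
    exact inf_le_inf (frameBox_le_map _) (frameBox_le_map _)
  · exact (inf_le_inf (frameBox_le _) (frameBox_le _)).trans himp_inf_le

theorem frameBox_himp_le_frameDiam (a b : H) :
    frameBox f (a ⇨ b) ≤ frameDiam f a ⇨ frameDiam f b := by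
  rw [le_himp_comm]
  apply frameDiam_le
  · rw [le_himp_iff]
    calc f (frameBox f (a ⇨ b) ⇨ frameDiam f b) ⊓ frameBox f (a ⇨ b)
        ≤ f (frameBox f (a ⇨ b) ⇨ frameDiam f b) ⊓ f (frameBox f (a ⇨ b)) :=
          inf_le_inf_left _ (frameBox_le_map _)
      _ = f ((frameBox f (a ⇨ b) ⇨ frameDiam f b) ⊓ frameBox f (a ⇨ b)) := (map_inf _ _ _).symm
      _ ≤ f (frameDiam f b) := OrderHomClass.mono f himp_inf_le
      _ ≤ frameDiam f b := map_frameDiam_le b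
  · rw [le_himp_comm]
    exact (frameBox_le _).trans (himp_le_himp_left (le_frameDiam b))

theorem frameDiam_sup_le (a b : H) :
    frameDiam f (a ⊔ b) ≤ frameDiam f a ⊔ frameDiam f b := by
  apply frameDiam_le
  · rw [map_sup]
    exact sup_le_sup (map_frameDiam_le a) (map_frameDiam_le b)
  · exact sup_le_sup (le_frameDiam a) (le_frameDiam b)

/-- If `f` preserves Heyting implication, then the algebraic form of FS◇ holds. -/
theorem frameDiam_himp_frameBox_le (hf : ∀ a b, f a ⇨ f b ≤ f (a ⇨ b)) (a b : H) :
    frameDiam f a ⇨ frameBox f b ≤ frameBox f (a ⇨ b) :=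
  le_frameBox
    ((himp_le_himp (map_frameDiam_le a) (frameBox_le_map b)).trans (hf _ _))
    (himp_le_himp (le_frameDiam a) (frameBox_le b))

/-- If `f` is idempotent, then the algebraic form of CD holds. -/
theorem frameBox_sup_le (hf : ∀ a, f (f a) = f a) (a b : H) :
    frameBox f (a ⊔ b) ≤ frameBox f a ⊔ frameDiam f b := by
  have hmap : frameBox f (a ⊔ b) ≤ f a ⊔ f b :=
    (frameBox_le_map _).trans ((OrderHomClass.mono f (frameBox_le _)).trans (map_sup f a b).le)
  have hfb : f b ≤ frameDiam f b :=
    (OrderHomClass.mono f (le_frameDiam b)).trans (map_frameDiam_le b)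
  have hbox : a ⊓ f a ≤ frameBox f a := by
    apply le_frameBox _ inf_le_left
    rw [map_inf, hf, inf_idem]
    exact inf_le_right
  calc frameBox f (a ⊔ b) ≤ (a ⊔ frameDiam f b) ⊓ (f a ⊔ frameDiam f b) :=
        le_inf ((frameBox_le _).trans (sup_le_sup_left (le_frameDiam b) a))
          (hmap.trans (sup_le_sup_left hfb _))
    _ = a ⊓ f a ⊔ frameDiam f b := (sup_inf_right _ _ _).symm
    _ ≤ frameBox f a ⊔ frameDiam f b := sup_le_sup_right hbox _

variable (f)

/-- The value of a formula in a frame with an endomorphism interpreting `◦`. -/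
def Formula.eval (v : ℕ → H) : Formula → H
  | .bot => ⊥
  | .var n => v n
  | .and φ ψ => φ.eval v ⊓ ψ.eval v
  | .or φ ψ => φ.eval v ⊔ ψ.eval v
  | .impl φ ψ => φ.eval v ⇨ ψ.eval v
  | .next φ => f (φ.eval v)
  | .diam φ => frameDiam f (φ.eval v)
  | .box φ => frameBox f (φ.eval v)

theorem ITL.eval_eq_top (v : ℕ → H) {Ax : Formula → Prop}
    (hAx : ∀ φ, Ax φ → φ.eval f v = ⊤) {φ : Formula} (h : ITL Ax φ) : φ.eval f v = ⊤ := by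
  induction h with
  | extra h => exact hAx _ h
  | then1 φ ψ => simp only [Formula.eval, himp_eq_top_iff]; exact le_himp
  | then2 φ ψ χ =>
    simp only [Formula.eval, himp_eq_top_iff]
    rw [le_himp_iff, ← himp_inf_distrib]
    exact himp_le_himp_left himp_inf_le
  | andE1 φ ψ => simp [Formula.eval]
  | andE2 φ ψ => simp [Formula.eval]
  | andI φ ψ => simp [Formula.eval]
  | orI1 φ ψ => simp [Formula.eval]
  | orI2 φ ψ => simp [Formula.eval]
  | orE φ ψ χ => simp [Formula.eval, sup_himp_distrib]
  | botE φ => simp [Formula.eval]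
  | nextBot => simp [Formula.eval, Formula.neg]
  | nextAnd φ ψ => simp [Formula.eval, Formula.iff]
  | nextOr φ ψ => simp [Formula.eval, Formula.iff]
  | nextK φ ψ => exact himp_eq_top_iff.2 (map_himp_le_himp_map _ _)
  | boxK φ ψ => exact himp_eq_top_iff.2 (frameBox_himp_le _ _)
  | diamK φ ψ => exact himp_eq_top_iff.2 (frameBox_himp_le_frameDiam _ _)
  | diamOr φ ψ => exact himp_eq_top_iff.2 (frameDiam_sup_le _ _)
  | boxFix φ => exact himp_eq_top_iff.2 (le_inf (frameBox_le _) (frameBox_le_map _))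
  | diamFix φ => exact himp_eq_top_iff.2 (sup_le (le_frameDiam _) (map_frameDiam_le _))
  | ind1 _ ih => exact himp_eq_top_iff.2 (le_frameBox (himp_eq_top_iff.1 ih) le_rfl)
  | ind2 _ ih => exact himp_eq_top_iff.2 (frameDiam_le (himp_eq_top_iff.1 ih) le_rfl)
  | mp _ _ ih₁ ih₂ => exact top_le_iff.1 (ih₂ ▸ himp_eq_top_iff.1 ih₁)
  | nec _ ih => exact (congrArg f ih).trans (map_top f)

variable {f}

theorem ITLFS.eval_eq_top (hf : ∀ a b, f a ⇨ f b ≤ f (a ⇨ b)) (v : ℕ → H) {φ : Formula}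
    (h : ITLFS φ) : φ.eval f v = ⊤ := by
  refine ITL.eval_eq_top f v ?_ h
  rintro _ ⟨φ, ψ, rfl | rfl⟩
  · exact himp_eq_top_iff.2 (hf _ _)
  · exact himp_eq_top_iff.2 (frameDiam_himp_frameBox_le hf _ _)

theorem ITLCD.eval_eq_top (hf : ∀ a, f (f a) = f a) (v : ℕ → H) {φ : Formula}
    (h : ITLCD φ) : φ.eval f v = ⊤ := by
  refine ITL.eval_eq_top f v ?_ h
  rintro _ ⟨φ, ψ, rfl⟩
  exact himp_eq_top_iff.2 (frameBox_sup_le hf _ _)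

end Algebraic

theorem ITL.mono {Ax Bx : Formula → Prop} (hAx : ∀ φ, Ax φ → Bx φ) {φ : Formula}
    (h : ITL Ax φ) : ITL Bx φ := by
  induction h with
  | extra h => exact .extra (hAx _ h)
  | then1 φ ψ => exact .then1 φ ψ
  | then2 φ ψ χ => exact .then2 φ ψ χ
  | andE1 φ ψ => exact .andE1 φ ψ
  | andE2 φ ψ => exact .andE2 φ ψ
  | andI φ ψ => exact .andI φ ψ
  | orI1 φ ψ => exact .orI1 φ ψ
  | orI2 φ ψ => exact .orI2 φ ψ
  | orE φ ψ χ => exact .orE φ ψ χ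
  | botE φ => exact .botE φ
  | nextBot => exact .nextBot
  | nextAnd φ ψ => exact .nextAnd φ ψ
  | nextOr φ ψ => exact .nextOr φ ψ
  | nextK φ ψ => exact .nextK φ ψ
  | boxK φ ψ => exact .boxK φ ψ
  | diamK φ ψ => exact .diamK φ ψ
  | diamOr φ ψ => exact .diamOr φ ψ
  | boxFix φ => exact .boxFix φ
  | diamFix φ => exact .diamFix φ
  | ind1 _ ih => exact .ind1 ih
  | ind2 _ ih => exact .ind2 ih
  | mp _ _ ih₁ ih₂ => exact .mp ih₁ ih₂
  | nec _ ih => exact .nec ih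

/-- The countermodel is the real line with the homeomorphism `x ↦ 2x`, where `p` is `(-∞, 1)` and
`q` is `(0, ∞)`: the point `0` satisfies `□(p ∨ q)` but neither `□p` nor `◇q`. -/
theorem not_ITLFS_CD :
    ¬ ITLFS (.impl (.box (.or pVar qVar)) (.or (.box pVar) (.diam qVar))) := by
  intro h
  let e : ℝ ≃ₜ ℝ := Homeomorph.mulLeft₀ 2 two_ne_zero
  let f : FrameHom (Opens ℝ) (Opens ℝ) := Opens.comap (e : C(ℝ, ℝ))
  have hf : ∀ a b, f a ⇨ f b ≤ f (a ⇨ b) := fun a b =>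
    (map_himp e.symm.opensCongr a b).ge
  let p : Opens ℝ := ⟨Set.Iio 1, isOpen_Iio⟩
  let q : Opens ℝ := ⟨Set.Ioi 0, isOpen_Ioi⟩
  have hle : frameBox f (p ⊔ q) ≤ frameBox f p ⊔ frameDiam f q :=
    himp_eq_top_iff.1 (ITLFS.eval_eq_top hf (fun n => if n = 0 then p else q) h)
  have hcover : (⊤ : Opens ℝ) ≤ p ⊔ q := fun x _ => lt_or_ge x 1 |>.imp id zero_lt_one.trans_le
  have hzero : (0 : ℝ) ∈ frameBox f p ⊔ frameDiam f q :=
    hle (le_frameBox (map_top f).ge hcover trivial)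
  rcases hzero with hbox | hdiam
  · obtain ⟨ε, hε, hball⟩ := Metric.isOpen_iff.1 (frameBox f p).isOpen 0 hbox
    have hiter : ∀ n : ℕ, (2 : ℝ) ^ n * (ε / 2) ∈ frameBox f p := by
      intro n
      induction n with
      | zero =>
        apply hball
        rw [Metric.mem_ball, dist_zero_right, Real.norm_eq_abs, abs_of_pos (by positivity)]
        linarith
      | succ n ih =>
        have hmem : 2 * ((2 : ℝ) ^ n * (ε / 2)) ∈ frameBox f p := frameBox_le_map p ih
        rwa [pow_succ', mul_assoc]
    obtain ⟨n, hn⟩ := pow_unbounded_of_one_lt (2 / ε) (one_lt_two (α := ℝ))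
    have hlt : (2 : ℝ) ^ n * (ε / 2) < 1 := frameBox_le p (hiter n)
    rw [div_lt_iff₀ hε] at hn
    linarith
  · have hq : f q ≤ q := fun x (hx : 0 < 2 * x) => show 0 < x by linarith
    exact lt_irrefl (0 : ℝ) (frameDiam_le hq le_rfl hdiam)

/-- The countermodel is the Sierpiński space with the map constant at the closed point `False`,
where `p` is the open point and `q` is empty. -/
theorem not_ITLCD_FS :
    ¬ ITLCD (.impl (.impl (.next pVar) (.next qVar)) (.next (.impl pVar qVar))) := by
  intro h
  let f : FrameHom (Opens Prop) (Opens Prop) := Opens.comap (ContinuousMap.const Prop False)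
  let p : Opens Prop := ⟨{True}, isOpen_singleton_true⟩
  have hle : f p ⇨ f ⊥ ≤ f (p ⇨ ⊥) :=
    himp_eq_top_iff.1
      (ITLCD.eval_eq_top (f := f) (fun _ => rfl) (fun n => if n = 0 then p else ⊥) h)
  have hp : f p = ⊥ := by
    ext x
    exact iff_of_false (fun hx : False = True => hx.symm ▸ trivial) id
  have hmem : False ∈ p ⇨ (⊥ : Opens Prop) :=
    hle (show True ∈ f p ⇨ f ⊥ by rw [hp, bot_himp]; trivial)
  have htrue : True ∈ p ⇨ (⊥ : Opens Prop) := by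
    have hnhds := (p ⇨ (⊥ : Opens Prop)).isOpen.mem_nhds hmem
    rw [nhds_false] at hnhds
    exact (Filter.mem_top.1 hnhds).ge (Set.mem_univ True)
  exact (himp_inf_le : (p ⇨ ⊥) ⊓ p ≤ ⊥) ⟨htrue, rfl⟩

/-- Theorem 4: the logics ITL⁰, ITL^FS, ITL^CD and ITL¹ are pairwise distinct:
ITL⁰ ⊊ ITL^FS, ITL⁰ ⊊ ITL^CD, ITL^FS and ITL^CD are incomparable (witnessed by
CD(p,q) and FS◦(p,q)), and both are strictly contained in ITL¹. -/
theorem logics_pairwise_distinct :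
    (∀ φ, ITL0 φ → ITLFS φ) ∧ (∃ φ, ITLFS φ ∧ ¬ ITL0 φ) ∧
    (∀ φ, ITL0 φ → ITLCD φ) ∧ (∃ φ, ITLCD φ ∧ ¬ ITL0 φ) ∧
    ITLCD (.impl (.box (.or pVar qVar)) (.or (.box pVar) (.diam qVar))) ∧
    ¬ ITLFS (.impl (.box (.or pVar qVar)) (.or (.box pVar) (.diam qVar))) ∧
    ITLFS (.impl (.impl (.next pVar) (.next qVar)) (.next (.impl pVar qVar))) ∧
    ¬ ITLCD (.impl (.impl (.next pVar) (.next qVar)) (.next (.impl pVar qVar))) ∧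
    (∀ φ, ITLFS φ → ITL1 φ) ∧ (∃ φ, ITL1 φ ∧ ¬ ITLFS φ) ∧
    (∀ φ, ITLCD φ → ITL1 φ) ∧ (∃ φ, ITL1 φ ∧ ¬ ITLCD φ) := by
  have hCD : CDAx (.impl (.box (.or pVar qVar)) (.or (.box pVar) (.diam qVar))) := ⟨_, _, rfl⟩
  have hFS : FSAx (.impl (.impl (.next pVar) (.next qVar)) (.next (.impl pVar qVar))) :=
    ⟨_, _, .inl rfl⟩
  have h0FS : ∀ φ, ITL0 φ → ITLFS φ := fun _ => ITL.mono fun _ => False.elim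
  have h0CD : ∀ φ, ITL0 φ → ITLCD φ := fun _ => ITL.mono fun _ => False.elim
  exact ⟨h0FS, ⟨_, .extra hFS, fun h => not_ITLCD_FS (h0CD _ h)⟩,
    h0CD, ⟨_, .extra hCD, fun h => not_ITLFS_CD (h0FS _ h)⟩,
    .extra hCD, not_ITLFS_CD, .extra hFS, not_ITLCD_FS,
    fun _ => ITL.mono fun _ => .inl, ⟨_, .extra (.inr hCD), not_ITLFS_CD⟩,
    fun _ => ITL.mono fun _ => .inr, ⟨_, .extra (.inl hFS), not_ITLCD_FS⟩⟩
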